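/- Let n > 2 and q > 0 be integers and let p be a prime with p > (q-1)n + 1. Then the exact identity ∑_{k=0}^{p-1} ((1-p)_k (q)_k^n / (1)_k^{n+1}) · (∑_{i=0}^{k-1} 1/(q+i) - H_k^{(1)}) = 0 holds in the rational numbers. -/

import Mathlib

/-- `H m k` is the `k`-th harmonic number of order `m`: `H_k^{(m)} = ∑_{j=1}^k 1/j^m`. -/
def harm (m k : ℕ) : ℚ := ∑ j ∈ Finset.range k, 1 / ((j : ℚ) + 1) ^ m

open Polynomial in
/-- Alternating binomial sums annihilate polynomials of small degree. -/
theorem Polynomial.sum_neg_one_pow_mul_choose_mul_eval_eq_zero {R : Type*} [CommRing R]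
    (P : R[X]) {N : ℕ} (hP : P.natDegree < N) :
    ∑ k ∈ Finset.range (N + 1), (-1) ^ k * (N.choose k : R) * P.eval (k : R) = 0 := by
  have h := congrFun (Polynomial.fwdDiff_iter_eq_zero_of_degree_lt hP) 0
  rw [fwdDiff_iter_eq_sum_shift] at h
  have h' := congrArg (fun x => (-1) ^ N * x) h
  simp only [Finset.mul_sum, Pi.zero_apply, mul_zero] at h'
  rw [← h']
  refine Finset.sum_congr rfl fun k hk => ?_
  obtain ⟨d, rfl⟩ := Nat.exists_eq_add_of_le (Nat.lt_succ_iff.mp (Finset.mem_range.mp hk))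
  have hd : ((-1 : R) ^ d) * (-1) ^ d = 1 := by rw [← mul_pow]; simp
  simp only [zsmul_eq_mul, nsmul_eq_mul, zero_add, mul_one, Nat.add_sub_cancel_left]
  push_cast
  rw [pow_add]
  linear_combination (-(-1 : R) ^ k * ((k + d).choose k : R) * P.eval (k : R)) * hd

theorem ascPochhammer_eval_neg_natCast {R : Type*} [CommRing R] (N k : ℕ) (hk : k ≤ N) :
    (ascPochhammer R k).eval (-(N : R)) =
      (-1) ^ k * (N.choose k : R) * (ascPochhammer R k).eval 1 := by
  induction k with
  | zero => simp
  | succ k ih =>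
    rw [ascPochhammer_succ_eval, ascPochhammer_succ_eval, ih (by omega)]
    have h : (N.choose (k + 1) : R) * (k + 1) = N.choose k * (N - k) := by
      have := congrArg (Nat.cast : ℕ → R) (Nat.choose_succ_right_eq N k)
      push_cast [Nat.cast_sub (show k ≤ N by omega)] at this
      exact this
    rw [pow_succ]
    linear_combination ((-1) ^ k * (ascPochhammer R k).eval 1) * h

theorem ascPochhammer_one_mul_comm {R : Type*} [CommRing R] (m k : ℕ) :
    (ascPochhammer R k).eval 1 * (ascPochhammer R m).eval ((k : R) + 1) =
      (ascPochhammer R m).eval 1 * (ascPochhammer R k).eval ((m : R) + 1) := by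
  have h := congrArg (Polynomial.eval (1 : R)) ((ascPochhammer_mul R k m).trans
    ((congrArg (ascPochhammer R) (add_comm k m)).trans (ascPochhammer_mul R m k).symm))
  simpa [add_comm] using h

theorem ascPochhammer_derivative_eval {K : Type*} [Field K] [LinearOrder K]
    [IsStrictOrderedRing K] (m : ℕ) {x : K} (hx : 0 < x) :
    (Polynomial.derivative (ascPochhammer K m)).eval x =
      (ascPochhammer K m).eval x * ∑ j ∈ Finset.range m, 1 / (x + j) := by
  induction m with
  | zero => simp
  | succ m ih =>
    have : x + m ≠ 0 := by positivity
    rw [Finset.sum_range_succ, ascPochhammer_succ_right]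
    simp only [Polynomial.derivative_mul, Polynomial.derivative_add, Polynomial.eval_add, Polynomial.eval_mul, ih,
      Polynomial.derivative_X, Polynomial.derivative_natCast, Polynomial.eval_X,
      Polynomial.eval_natCast, Polynomial.eval_one, Polynomial.eval_zero]
    field_simp
    ring

theorem sum_one_div_sub_harm (m k : ℕ) :
    (∑ i ∈ Finset.range k, 1 / ((m : ℚ) + 1 + i)) - harm 1 k =
      (∑ j ∈ Finset.range m, 1 / ((k : ℚ) + 1 + j)) - harm 1 m := by
  have h := (Finset.sum_range_add (fun j => 1 / ((j : ℚ) + 1)) k m).symm.trans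
    ((congrArg (fun t => ∑ j ∈ Finset.range t, 1 / ((j : ℚ) + 1)) (add_comm k m)).trans
      (Finset.sum_range_add (fun j => 1 / ((j : ℚ) + 1)) m k))
  simp only [Nat.cast_add, add_right_comm _ _ (1 : ℚ)] at h
  simp only [harm, pow_one]
  linarith

/-- Let `n > 2`, `q > 0` be integers and `p` a prime with `p > (q-1)n + 1`.
Then `∑_{k=0}^{p-1} ((1-p)_k (q)_k^n / (1)_k^{n+1}) (∑_{i=0}^{k-1} 1/(q+i) - H_k^{(1)}) = 0`
holds exactly in `ℚ`. -/
theorem stmt_16 (n q : ℕ) (hn : 2 < n) (hq : 0 < q)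
    (p : ℕ) (hp : p.Prime) (hgt : p > (q - 1) * n + 1) :
    ∑ k ∈ Finset.range p,
        (((ascPochhammer ℚ k).eval (1 - (p : ℚ)) * ((ascPochhammer ℚ k).eval (q : ℚ)) ^ n) /
            ((ascPochhammer ℚ k).eval 1) ^ (n + 1)) *
          ((∑ i ∈ Finset.range k, 1 / ((q : ℚ) + (i : ℚ))) - harm 1 k)
      = 0 := by
  obtain ⟨m, rfl⟩ : ∃ m, q = m + 1 := ⟨q - 1, by omega⟩
  obtain ⟨N, rfl⟩ : ∃ N, p = N + 1 := ⟨p - 1, by omega⟩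
  obtain ⟨n, rfl⟩ : ∃ l, n = l + 1 := ⟨n - 1, by omega⟩
  have hmN : m * (n + 1) < N := by simpa using hgt
  set P : Polynomial ℚ := Polynomial.C ((ascPochhammer ℚ m).eval 1)⁻¹ *
    (ascPochhammer ℚ m).comp (Polynomial.X + 1) with hPdef
  have hP : P.natDegree ≤ m := by
    refine (Polynomial.natDegree_C_mul_le _ _).trans (Polynomial.natDegree_comp_le.trans ?_)
    rw [ascPochhammer_natDegree, ← Polynomial.C_1, Polynomial.natDegree_X_add_C, mul_one]
  have hdeg : (P ^ n * (Polynomial.derivative P - Polynomial.C (harm 1 m) * P)).natDegree < N := by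
    refine lt_of_le_of_lt (Polynomial.natDegree_mul_le_of_le
      (Polynomial.natDegree_pow_le_of_le n hP)
      (Polynomial.natDegree_sub_le_of_le
        ((Polynomial.natDegree_derivative_le P).trans ((Nat.sub_le _ _).trans hP))
        ((Polynomial.natDegree_C_mul_le _ _).trans hP))) ?_
    rw [max_self]
    linarith
  rw [← Polynomial.sum_neg_one_pow_mul_choose_mul_eval_eq_zero _ hdeg]
  refine Finset.sum_congr rfl fun k hk => ?_
  have hk' : (ascPochhammer ℚ k).eval 1 ≠ 0 := (ascPochhammer_pos k 1 one_pos).ne'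
  have hm' : (ascPochhammer ℚ m).eval 1 ≠ 0 := (ascPochhammer_pos m 1 one_pos).ne'
  have hPk : P.eval (k : ℚ) =
      (ascPochhammer ℚ k).eval ((m : ℚ) + 1) / (ascPochhammer ℚ k).eval 1 := by
    rw [eq_div_iff hk']
    simp only [hPdef, Polynomial.eval_mul, Polynomial.eval_C, Polynomial.eval_comp,
      Polynomial.eval_add, Polynomial.eval_X, Polynomial.eval_one]
    rw [mul_assoc, mul_comm (Polynomial.eval _ _) (Polynomial.eval 1 _),
      ascPochhammer_one_mul_comm, inv_mul_cancel_left₀ hm']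
  have hdP : (Polynomial.derivative P).eval (k : ℚ) =
      P.eval (k : ℚ) * ∑ j ∈ Finset.range m, 1 / ((k : ℚ) + 1 + j) := by
    have hkpos : (0 : ℚ) < k + 1 := by positivity
    simp [hPdef, Polynomial.derivative_comp, ascPochhammer_derivative_eval m hkpos, mul_assoc]
  push_cast
  rw [sum_one_div_sub_harm, show (1 : ℚ) - (N + 1) = -N by ring,
    ascPochhammer_eval_neg_natCast N k (Nat.lt_succ_iff.mp (Finset.mem_range.mp hk))]
  simp only [Polynomial.eval_mul, Polynomial.eval_pow, Polynomial.eval_sub, Polynomial.eval_C,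
    hdP, hPk, div_pow]
  field_simp
  ring
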